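/- Define the large Schröder numbers S : ℕ → ℕ by S 0 = 1 and S (n+1) = S n + ∑_{j=0}^{n} S j · S (n−j). Then for every n ≥ 1, the number of full permutations of Fin n equals S (n−1). -/

import Mathlib

/-- Two cells of the `n × n` board are cardinal (north/south/east/west) neighbors. -/
def Adj {n : ℕ} (c d : Fin n × Fin n) : Prop :=
  (c.1 = d.1 ∧ ((c.2 : ℕ) + 1 = (d.2 : ℕ) ∨ (d.2 : ℕ) + 1 = (c.2 : ℕ))) ∨
  (c.2 = d.2 ∧ ((c.1 : ℕ) + 1 = (d.1 : ℕ) ∨ (d.1 : ℕ) + 1 = (c.1 : ℕ)))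

/-- A cell `c` is mutable for a set `T` of cells: `c ∉ T` and at least two of its
cardinal neighbors belong to `T`. -/
def IsMutable {n : ℕ} (T : Set (Fin n × Fin n)) (c : Fin n × Fin n) : Prop :=
  c ∉ T ∧ ∃ d ∈ T, ∃ e ∈ T, d ≠ e ∧ Adj c d ∧ Adj c e

/-- One percolation step: adjoin a single mutable cell. -/
def PercStep {n : ℕ} (T T' : Set (Fin n × Fin n)) : Prop :=
  ∃ c, IsMutable T c ∧ T' = T ∪ {c}

/-- The graph of a permutation `π`, i.e. the set of cells `(i, π i)`. -/
def graphOf {n : ℕ} (π : Equiv.Perm (Fin n)) : Set (Fin n × Fin n) :=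
  {p | p.2 = π p.1}

/-- A set of cells is percolation-closed if it contains every cell having at least two
cardinal neighbors in the set. -/
def PercClosed {n : ℕ} (S : Set (Fin n × Fin n)) : Prop :=
  ∀ c, (∃ d ∈ S, ∃ e ∈ S, d ≠ e ∧ Adj c d ∧ Adj c e) → c ∈ S

/-- The percolation closure of `π`: the smallest percolation-closed set containing the
graph of `π`. -/
def percClosure {n : ℕ} (π : Equiv.Perm (Fin n)) : Set (Fin n × Fin n) :=
  ⋂₀ {S | graphOf π ⊆ S ∧ PercClosed S}

/-- `π` is full if its percolation closure is the whole board. -/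
def Full {n : ℕ} (π : Equiv.Perm (Fin n)) : Prop :=
  percClosure π = Set.univ

/-- A permutation of `Fin m` is indecomposable if it maps no proper initial segment
`{0, …, k−1}` (with `1 ≤ k < m`) onto itself. -/
def Indecomposable {m : ℕ} (σ : Equiv.Perm (Fin m)) : Prop :=
  ¬ ∃ k, 1 ≤ k ∧ k < m ∧
    (fun i => σ i) '' {i : Fin m | (i : ℕ) < k} = {i : Fin m | (i : ℕ) < k}

/-- `π` is no-growth if no cell is mutable for its graph. -/
def NoGrowth {n : ℕ} (π : Equiv.Perm (Fin n)) : Prop :=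
  ∀ c, ¬ IsMutable (graphOf π) c

/-- The number of full permutations of `Fin m`. -/
noncomputable def numFull (m : ℕ) : ℕ :=
  Nat.card {π : Equiv.Perm (Fin m) // Full π}

/-- The number of full indecomposable permutations of `Fin m`. -/
noncomputable def numFullIndec (m : ℕ) : ℕ :=
  Nat.card {π : Equiv.Perm (Fin m) // Full π ∧ Indecomposable π}


/-! ### Good lists -/

def opl (x y : List ℕ) : List ℕ := x ++ y.map (· + x.length)
def omi (x y : List ℕ) : List ℕ := x.map (· + y.length) ++ y

lemma opl_length (x y : List ℕ) : (opl x y).length = x.length + y.length := by simp [opl]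
lemma omi_length (x y : List ℕ) : (omi x y).length = x.length + y.length := by simp [omi]

inductive Good : List ℕ → Prop
  | single : Good [0]
  | plus {x y} : Good x → Good y → Good (opl x y)
  | minus {x y} : Good x → Good y → Good (omi x y)

lemma Good.pos {l} (h : Good l) : 0 < l.length := by
  induction h with
  | single => simp
  | plus _ _ h1 h2 => rw [opl_length]; omega
  | minus _ _ h1 h2 => rw [omi_length]; omega

lemma mem_opl {x y : List ℕ} {v : ℕ} :
    v ∈ opl x y ↔ v ∈ x ∨ ∃ w ∈ y, w + x.length = v := by simp [opl]
lemma mem_omi {x y : List ℕ} {v : ℕ} :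
    v ∈ omi x y ↔ (∃ w ∈ x, w + y.length = v) ∨ v ∈ y := by simp [omi]

lemma Good.mem {l} (h : Good l) : ∀ v, v ∈ l ↔ v < l.length := by
  induction h with
  | single => simp
  | @plus x y _ _ h1 h2 =>
    intro v
    rw [mem_opl, opl_length, h1]
    constructor
    · rintro (h | ⟨w, hw, rfl⟩)
      · omega
      · rw [h2] at hw; omega
    · intro h
      by_cases hv : v < x.length
      · exact Or.inl hv
      · exact Or.inr ⟨v - x.length, by rw [h2]; omega, by omega⟩
  | @minus x y _ _ h1 h2 =>
    intro v
    rw [mem_omi, omi_length, h2]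
    constructor
    · rintro (⟨w, hw, rfl⟩ | h)
      · rw [h1] at hw; omega
      · omega
    · intro h
      by_cases hv : v < y.length
      · exact Or.inr hv
      · exact Or.inl ⟨v - y.length, by rw [h1]; omega, by omega⟩

lemma Good.perm {l} (h : Good l) : l.Perm (List.range l.length) := by
  have h1 : (List.range l.length) ⊆ l := by
    intro v hv
    rw [h.mem]; simpa using hv
  exact ((List.subperm_of_subset List.nodup_range h1).perm_of_length_le (by simp)).symm

lemma opl_assoc (x y z : List ℕ) : opl (opl x y) z = opl x (opl y z) := by
  simp [opl, List.map_append, Function.comp_def, add_comm, add_left_comm, add_assoc]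

lemma opl_reverse (x y : List ℕ) : (opl x y).reverse = omi y.reverse x.reverse := by
  simp [opl, omi]
lemma omi_reverse (x y : List ℕ) : (omi x y).reverse = opl y.reverse x.reverse := by
  simp [opl, omi]

lemma Good.reverse {l} (h : Good l) : Good l.reverse := by
  induction h with
  | single => exact Good.single
  | plus _ _ h1 h2 => rw [opl_reverse]; exact Good.minus h2 h1
  | minus _ _ h1 h2 => rw [omi_reverse]; exact Good.plus h2 h1

def IsP (l : List ℕ) : Prop := ∃ x y, Good x ∧ Good y ∧ l = opl x y
def IsM (l : List ℕ) : Prop := ∃ x y, Good x ∧ Good y ∧ l = omi x y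

lemma IsP.good {l} : IsP l → Good l := by
  rintro ⟨x, y, hx, hy, rfl⟩; exact hx.plus hy
lemma IsM.good {l} : IsM l → Good l := by
  rintro ⟨x, y, hx, hy, rfl⟩; exact hx.minus hy

lemma IsP.two_le {l} : IsP l → 2 ≤ l.length := by
  rintro ⟨x, y, hx, hy, rfl⟩
  have := hx.pos
  have := hy.pos
  rw [opl_length]; omega

lemma isM_iff {l} : IsM l ↔ IsP l.reverse := by
  constructor
  · rintro ⟨x, y, hx, hy, rfl⟩
    exact ⟨_, _, hy.reverse, hx.reverse, omi_reverse _ _⟩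
  · rintro ⟨x, y, hx, hy, h⟩
    refine ⟨_, _, hy.reverse, hx.reverse, ?_⟩
    rw [← opl_reverse, ← h, List.reverse_reverse]

lemma Good.cases3 {l} (h : Good l) : l = [0] ∨ IsP l ∨ IsM l := by
  cases h with
  | single => exact Or.inl rfl
  | plus h1 h2 => exact Or.inr (Or.inl ⟨_, _, h1, h2, rfl⟩)
  | minus h1 h2 => exact Or.inr (Or.inr ⟨_, _, h1, h2, rfl⟩)

/-- a minus list is not of the form `u ⊕ z` with `u` good and `z` nonempty -/
lemma minus_ne {x y u z : List ℕ} (hx : Good x) (hy : Good y) (hu : Good u)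
    (hz : z ≠ []) : omi x y ≠ opl u z := by
  intro h
  have hxp := hx.pos
  have hyp := hy.pos
  have hup := hu.pos
  have hlen : x.length + y.length = u.length + z.length := by
    rw [← omi_length, h, opl_length]
  have hzp : 0 < z.length := List.length_pos_iff.2 hz
  -- the max sits in x; its position is in z-part; so x is longer than u
  obtain ⟨i, hi, hi0⟩ := List.mem_iff_getElem.1 ((hu.mem 0).2 hup)
  by_cases hc : x.length ≤ u.length
  · obtain ⟨j, hj, hj0⟩ := List.mem_iff_getElem.1 ((hx.mem (x.length - 1)).2 (by omega))
    have h1 : (omi x y)[j]'(by rw [omi_length]; omega) = x.length - 1 + y.length := by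
      simp only [omi]
      rw [List.getElem_append_left (by simpa using hj)]
      simp [hj0]
    have h2 : (opl u z)[j]'(by rw [opl_length]; omega) = u[j]'(by omega) := by
      simp only [opl]
      rw [List.getElem_append_left (by omega)]
    have h3 : u[j]'(by omega) < u.length := (hu.mem _).1 (List.getElem_mem _)
    have h4 : (omi x y)[j]'(by rw [omi_length]; omega) = (opl u z)[j]'(by rw [opl_length]; omega) := by
      simp only [h]
    omega
  · have h1 : (omi x y)[i]'(by rw [omi_length]; omega) = x[i]'(by omega) + y.length := by
      simp only [omi]
      rw [List.getElem_append_left (by simp; omega)]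
      simp
    have h2 : (opl u z)[i]'(by rw [opl_length]; omega) = u[i]'(by omega) := by
      simp only [opl]
      rw [List.getElem_append_left (by omega)]
    have h4 : (omi x y)[i]'(by rw [omi_length]; omega) = (opl u z)[i]'(by rw [opl_length]; omega) := by
      simp only [h]
    omega

lemma not_P_M {l} (h1 : IsP l) (h2 : IsM l) : False := by
  obtain ⟨x, y, hx, hy, rfl⟩ := h1
  obtain ⟨u, z, hu, hz, h⟩ := h2
  exact minus_ne hu hz hx (List.length_pos_iff.1 hy.pos) h.symm

/-- A good list which is not a plus. -/
def IsI (l : List ℕ) : Prop := Good l ∧ ¬ IsP l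

lemma IsI.ne {l u z} (h : IsI l) (hu : Good u) (hz : z ≠ []) : l ≠ opl u z := by
  rcases h.1.cases3 with rfl | h' | ⟨x, y, hx, hy, rfl⟩
  · intro h
    have := congrArg List.length h
    rw [opl_length] at this
    have := hu.pos
    have : 0 < z.length := List.length_pos_iff.2 hz
    simp at *
    omega
  · exact absurd h' h.2
  · exact minus_ne hx hy hu hz

lemma exists_I {l} (h : Good l) : IsP l → ∃ x y, IsI x ∧ Good y ∧ l = opl x y := by
  induction h with
  | single =>
    intro h
    have := h.two_le
    simp at this
  | @plus x y hx hy h1 h2 =>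
    intro _
    by_cases hP : IsP x
    · obtain ⟨u, v, hu, hv, rfl⟩ := h1 hP
      exact ⟨u, opl v y, hu, hv.plus hy, opl_assoc _ _ _⟩
    · exact ⟨x, y, ⟨hx, hP⟩, hy, rfl⟩
  | minus hx hy =>
    intro h
    exact (not_P_M h ⟨_, _, hx, hy, rfl⟩).elim

lemma uniq_aux {x y u v : List ℕ} (hx : IsI x) (hu : IsI u)
    (h : opl x y = opl u v) : x.length ≤ u.length := by
  by_contra hc
  push Not at hc
  have h1 : x = u ++ (x.drop u.length) := by
    have : u = x.take u.length := by
      have h2 := congrArg (List.take u.length) h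
      simp only [opl] at h2
      rw [List.take_append_of_le_length hc.le, List.take_left] at h2
      exact h2.symm
    conv_lhs => rw [← List.take_append_drop u.length x]
    rw [← this]
  have h3 : x.drop u.length ++ y.map (· + x.length) = v.map (· + u.length) := by
    simp only [opl] at h
    rw [h1, List.append_assoc] at h
    have := List.append_cancel_left h
    rw [← h1] at this
    exact this
  have h4 : ∀ w ∈ x.drop u.length, u.length ≤ w := by
    intro w hw
    have : w ∈ v.map (· + u.length) := by rw [← h3]; simp [hw]
    simp at this
    obtain ⟨a, _, rfl⟩ := this
    omega
  refine hx.ne hu.1 (z := (x.drop u.length).map (· - u.length)) ?_ ?_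
  · intro h
    have := congrArg List.length h
    simp at this
    omega
  · conv_lhs => rw [h1]
    simp only [opl, List.map_map]
    congr 1
    conv_lhs => rw [← List.map_id (x.drop u.length)]
    apply List.map_congr_left
    intro w hw
    have := h4 w hw
    simp
    omega

lemma uniq {x y u v : List ℕ} (hx : IsI x) (hu : IsI u)
    (h : opl x y = opl u v) : x = u ∧ y = v := by
  have hl := le_antisymm (uniq_aux hx hu h) (uniq_aux hu hx h.symm)
  simp only [opl] at h
  obtain ⟨h1, h2⟩ := List.append_inj h hl
  subst h1
  refine ⟨rfl, ?_⟩
  exact List.map_injective_iff.2 (fun a b h => by simpa using h) h2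

/-! ### Counting -/

lemma fin_good (n : ℕ) : {l | Good l ∧ l.length = n}.Finite := by
  refine ((List.range n).permutations.finite_toSet).subset ?_
  rintro l ⟨h, rfl⟩
  simpa using h.perm

open Classical in
noncomputable def W (n : ℕ) : Finset (List ℕ) := (fin_good n).toFinset
lemma mem_W {n l} : l ∈ W n ↔ Good l ∧ l.length = n := by simp [W]

open Classical in
noncomputable def Pn (n : ℕ) : Finset (List ℕ) := (W n).filter IsP
open Classical in
noncomputable def In (n : ℕ) : Finset (List ℕ) := (W n).filter (fun l => ¬ IsP l)

lemma mem_Pn {n l} : l ∈ Pn n ↔ IsP l ∧ l.length = n := by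
  simp only [Pn, Finset.mem_filter, mem_W]
  exact ⟨fun h => ⟨h.2, h.1.2⟩, fun h => ⟨⟨h.1.good, h.2⟩, h.1⟩⟩
lemma mem_In {n l} : l ∈ In n ↔ IsI l ∧ l.length = n := by
  simp only [In, Finset.mem_filter, mem_W, IsI]
  tauto

lemma card_PI (n : ℕ) : (Pn n).card + (In n).card = (W n).card := by
  classical
  simp only [Pn, In]
  exact Finset.card_filter_add_card_filter_not _

lemma len_one {l} (h : Good l) (h1 : l.length = 1) : l = [0] := by
  obtain ⟨a, rfl⟩ := List.length_eq_one_iff.1 h1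
  have := (h.mem a).1 (by simp)
  simp at this
  simp [this]

lemma W_one : W 1 = {[0]} := by
  ext l
  simp only [mem_W, Finset.mem_singleton]
  constructor
  · rintro ⟨h, h1⟩; exact len_one h h1
  · rintro rfl; exact ⟨Good.single, rfl⟩

lemma In_one : (In 1).card = 1 := by
  have h : Pn 1 = ∅ := by
    ext l
    simp only [mem_Pn, Finset.notMem_empty, iff_false]
    rintro ⟨h, h1⟩
    have := h.two_le
    omega
  have := card_PI 1
  rw [h, W_one] at this
  simpa using this

lemma In_eq {n : ℕ} (hn : 2 ≤ n) : (In n).card = (Pn n).card := by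
  have h : In n = (Pn n).image List.reverse := by
    ext l
    simp only [mem_In, Finset.mem_image, mem_Pn]
    constructor
    · rintro ⟨h, h1⟩
      refine ⟨l.reverse, ⟨?_, by simpa using h1⟩, by simp⟩
      rcases h.1.cases3 with rfl | h' | h'
      · simp at h1; omega
      · exact absurd h' h.2
      · exact isM_iff.1 h'
    · rintro ⟨m, ⟨hm, h1⟩, rfl⟩
      have : IsM m.reverse := isM_iff.2 (by simpa using hm)
      exact ⟨⟨this.good, fun h => not_P_M h this⟩, by simpa using h1⟩
  rw [h, Finset.card_image_of_injective _ List.reverse_injective]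

lemma card_Pn (n : ℕ) : (Pn (n + 2)).card =
    ∑ k ∈ Finset.range (n + 1), (In (k + 1)).card * (W (n + 1 - k)).card := by
  classical
  have h : Pn (n + 2) = (Finset.range (n + 1)).biUnion
      (fun k => (In (k + 1) ×ˢ W (n + 1 - k)).image (fun p => opl p.1 p.2)) := by
    ext l
    simp only [mem_Pn, Finset.mem_biUnion, Finset.mem_image, Finset.mem_product, Prod.exists,
      mem_In, mem_W, Finset.mem_range]
    constructor
    · rintro ⟨h, h1⟩
      obtain ⟨x, y, hx, hy, rfl⟩ := exists_I h.good h
      rw [opl_length] at h1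
      have := hx.1.pos
      have := hy.pos
      exact ⟨x.length - 1, by omega, x, y, ⟨⟨hx, by omega⟩, hy, by omega⟩, rfl⟩
    · rintro ⟨k, hk, x, y, ⟨⟨hx, h1⟩, hy, h2⟩, rfl⟩
      refine ⟨⟨x, y, hx.1, hy, rfl⟩, ?_⟩
      rw [opl_length]; omega
  rw [h, Finset.card_biUnion]
  · apply Finset.sum_congr rfl
    intro k _
    rw [Finset.card_image_of_injOn, Finset.card_product]
    rintro ⟨x, y⟩ h1 ⟨u, v⟩ h2 h3
    simp only [Finset.coe_product, Set.mem_prod, Finset.mem_coe, mem_In] at h1 h2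
    obtain ⟨rfl, rfl⟩ := uniq h1.1.1 h2.1.1 h3
    rfl
  · intro i _ j _ hij
    rw [Function.onFun, Finset.disjoint_left]
    intro l h1 h2
    simp only [Finset.mem_image, Finset.mem_product, Prod.exists, mem_In] at h1 h2
    obtain ⟨x, y, ⟨⟨hx, h1⟩, _⟩, rfl⟩ := h1
    obtain ⟨u, v, ⟨⟨hu, h2⟩, _⟩, h3⟩ := h2
    obtain ⟨rfl, rfl⟩ := uniq hu hx h3
    omega

lemma card_W_rec (n : ℕ) : (W (n + 2)).card = (W (n + 1)).card +
    ∑ k ∈ Finset.range (n + 1), (W (k + 1)).card * (W (n - k + 1)).card := by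
  have h1 := card_PI (n + 2)
  rw [In_eq (by omega), card_Pn] at h1
  have h2 : ∀ k, (In (k + 1)).card + (In (k + 1)).card
      = (W (k + 1)).card + if k = 0 then 1 else 0 := by
    intro k
    rcases k with _ | k
    · simp [W_one, In_one]
    · have := card_PI (k + 1 + 1)
      have := In_eq (n := k + 1 + 1) (by omega)
      simp
      omega
  rw [← h1, ← Finset.sum_add_distrib]
  simp_rw [← add_mul, h2, add_mul]
  rw [Finset.sum_add_distrib, add_comm]
  congr 1
  · simp
  · apply Finset.sum_congr rfl
    intro k hk
    have := Finset.mem_range.1 hk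
    rw [show n + 1 - k = n - k + 1 by omega]

lemma card_W_S (S : ℕ → ℕ) (hS0 : S 0 = 1)
    (hS : ∀ n, S (n + 1) = S n + ∑ j ∈ Finset.range (n + 1), S j * S (n - j)) (n : ℕ) :
    (W (n + 1)).card = S n := by
  induction n using Nat.strong_induction_on with
  | _ n ih =>
    rcases n with _ | n
    · simp [W_one, hS0]
    · rw [hS, card_W_rec, ih n (by omega)]
      congr 1
      apply Finset.sum_congr rfl
      intro k hk
      have := Finset.mem_range.1 hk
      rw [ih k (by omega), ih (n - k) (by omega)]

/-! ### Blocks -/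

inductive Blk (f : ℕ → ℕ) : ℕ → ℕ → ℕ → Prop
  | single (a) : Blk f a (f a) 1
  | plus {a b m m'} : Blk f a b m → Blk f (a + m) (b + m) m' → Blk f a b (m + m')
  | minus {a b m m'} : Blk f a (b + m') m → Blk f (a + m) b m' → Blk f a b (m + m')

lemma Blk.good {f a b m} (h : Blk f a b m) :
    Good ((List.range m).map (fun i => f (a + i) - b)) ∧ ∀ i < m, b ≤ f (a + i) := by
  induction h with
  | single a => simpa using Good.single
  | @plus a b m m' _ _ h1 h2 =>
    obtain ⟨h1, h1'⟩ := h1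
    obtain ⟨h2, h2'⟩ := h2
    constructor
    · have := h1.plus h2
      convert this using 1
      rw [opl, List.range_add, List.map_append, List.map_map, List.map_map]
      congr 1
      apply List.map_congr_left
      intro i hi
      have := h2' i (by simpa using hi)
      simp [← add_assoc] at this ⊢
      omega
    · intro i hi
      by_cases hm : i < m
      · exact h1' i hm
      · have := h2' (i - m) (by omega)
        rw [show a + m + (i - m) = a + i by omega] at this
        omega
  | @minus a b m m' _ _ h1 h2 =>
    obtain ⟨h1, h1'⟩ := h1
    obtain ⟨h2, h2'⟩ := h2
    constructor
    · have := h1.minus h2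
      convert this using 1
      rw [omi, List.range_add, List.map_append, List.map_map, List.map_map]
      congr 1
      · apply List.map_congr_left
        intro i hi
        have := h1' i (by simpa using hi)
        simp at this ⊢
        omega
      · apply List.map_congr_left
        intro i hi
        simp [← add_assoc]
    · intro i hi
      by_cases hm : i < m
      · have := h1' i hm; omega
      · have := h2' (i - m) (by omega)
        rw [show a + m + (i - m) = a + i by omega] at this
        omega

lemma Blk.range {f a b m} (h : Blk f a b m) (v : ℕ) :
    (∃ i, a ≤ i ∧ i < a + m ∧ f i = v) ↔ b ≤ v ∧ v < b + m := by
  obtain ⟨h1, h2⟩ := h.good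
  have h3 := h1.mem
  simp only [List.length_map, List.length_range, List.mem_map, List.mem_range] at h3
  constructor
  · rintro ⟨i, hi, hi', rfl⟩
    have h4 := h2 (i - a) (by omega)
    have h5 := (h3 (f (a + (i - a)) - b)).1 ⟨i - a, by omega, rfl⟩
    rw [show a + (i - a) = i by omega] at h4 h5
    omega
  · rintro ⟨h4, h5⟩
    obtain ⟨i, hi, hv⟩ := (h3 (v - b)).2 (by omega)
    have := h2 i hi
    exact ⟨a + i, by omega, by omega, by omega⟩

/-- Partition of rows `< n` into blocks; `A i`, `B i`, `M i` are the data of the block of row `i`. -/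
structure BPart (f : ℕ → ℕ) (n : ℕ) (A B M : ℕ → ℕ) : Prop where
  blk : ∀ i < n, Blk f (A i) (B i) (M i)
  le : ∀ i < n, A i ≤ i
  lt : ∀ i < n, i < A i + M i
  bd : ∀ i < n, A i + M i ≤ n
  con : ∀ i < n, ∀ j, A i ≤ j → j < A i + M i → A j = A i ∧ B j = B i ∧ M j = M i

lemma exists_max (f : ℕ → ℕ) (n : ℕ) : ∃ A B M, BPart f n A B M ∧
    ∀ A' B' M', BPart f n A' B' M' →
      ∑ i ∈ Finset.range n, M' i ≤ ∑ i ∈ Finset.range n, M i := by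
  let K : Set ℕ := {s | ∃ A B M, BPart f n A B M ∧ s = ∑ i ∈ Finset.range n, M i}
  have hne : K.Nonempty := by
    refine ⟨_, id, f, fun _ => 1, ?_, rfl⟩
    constructor
    · intro i _; exact Blk.single i
    · intro i _; simp
    · intro i _; simp
    · intro i hi; simp; omega
    · intro i _ j h1 h2
      simp at h1 h2
      have : i = j := by omega
      simp [this]
  have hbd : BddAbove K := by
    refine ⟨n * n, ?_⟩
    rintro s ⟨A, B, M, h, rfl⟩
    calc _ ≤ ∑ i ∈ Finset.range n, n := by
          apply Finset.sum_le_sum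
          intro i hi
          have := h.bd i (by simpa using hi)
          omega
      _ = n * n := by simp
  obtain ⟨A, B, M, h, hs⟩ := Nat.sSup_mem hne hbd
  refine ⟨A, B, M, h, ?_⟩
  intro A' B' M' h'
  rw [← hs]
  exact le_csSup hbd ⟨A', B', M', h', rfl⟩

lemma no_merge {f n A B M} (h : BPart f n A B M)
    (hmax : ∀ A' B' M', BPart f n A' B' M' →
      ∑ i ∈ Finset.range n, M' i ≤ ∑ i ∈ Finset.range n, M i)
    {x y : ℕ} (hx : x < n) (hy : y < n) (hA : A x + M x = A y)
    (b : ℕ) (hblk : Blk f (A x) b (M x + M y)) : False := by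
  classical
  let Q : ℕ → Prop := fun i => A x ≤ i ∧ i < A x + (M x + M y)
  have hx1 := h.le x hx
  have hx2 := h.lt x hx
  have hy1 := h.le y hy
  have hy2 := h.lt y hy
  have hy3 := h.bd y hy
  have hQ : ∀ i, Q i → (A i = A x ∧ B i = B x ∧ M i = M x) ∨ (A i = A y ∧ B i = B y ∧ M i = M y) := by
    rintro i ⟨h1, h2⟩
    by_cases hi : i < A x + M x
    · exact Or.inl (h.con x hx i h1 hi)
    · exact Or.inr (h.con y hy i (by omega) (by omega))
  have hP : BPart f n (fun i => if Q i then A x else A i) (fun i => if Q i then b else B i)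
      (fun i => if Q i then M x + M y else M i) := by
    constructor
    · intro i hi
      by_cases q : Q i
      · simpa [q] using hblk
      · simpa [q] using h.blk i hi
    · intro i hi
      by_cases q : Q i
      · simpa [q] using q.1
      · simpa [q] using h.le i hi
    · intro i hi
      by_cases q : Q i
      · simpa [q] using q.2
      · simpa [q] using h.lt i hi
    · intro i hi
      by_cases q : Q i
      · simp [q]; omega
      · simpa [q] using h.bd i hi
    · intro i hi j
      by_cases q : Q i
      · simp only [q, if_true]
        intro h1 h2
        have qj : Q j := ⟨h1, h2⟩
        simp [qj]
      · simp only [q, if_false]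
        intro h1 h2
        have hc := h.con i hi j h1 h2
        have qj : ¬ Q j := by
          intro qj
          apply q
          have h3 := h.le i hi
          have h4 := h.lt i hi
          have := hQ j qj
          constructor <;> omega
        simpa [qj] using hc
  have := hmax _ _ _ hP
  refine absurd this (not_le.2 ?_)
  apply Finset.sum_lt_sum
  · intro i hi
    by_cases q : Q i
    · have := hQ i q
      simp only [q, if_true]; omega
    · simp [q]
  · refine ⟨x, by simpa using hx, ?_⟩
    have q : Q x := ⟨hx1, by omega⟩
    simp only [q, if_true]; omega

/-- inside test -/
def Ins (B M : ℕ → ℕ) (x y : ℕ) : Prop := B x ≤ y ∧ y < B x + M x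

lemma same_blk {f n A B M} (h : BPart f n A B M) (hf : ∀ i < n, ∀ j < n, f i = f j → i = j)
    {x x' y : ℕ} (hx : x < n) (hx' : x' < n) (h1 : Ins B M x y) (h2 : Ins B M x' y) :
    A x = A x' ∧ B x = B x' ∧ M x = M x' := by
  obtain ⟨i, hi, hi', e⟩ := ((h.blk x hx).range y).2 h1
  obtain ⟨j, hj, hj', e'⟩ := ((h.blk x' hx').range y).2 h2
  have b1 := h.bd x hx
  have b2 := h.bd x' hx'
  have : i = j := hf _ (by omega) _ (by omega) (by omega)
  subst this
  have := h.con x hx i hi hi'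
  have := h.con x' hx' i hj hj'
  omega

lemma diag {f n A B M} (h : BPart f n A B M) (hf : ∀ i < n, ∀ j < n, f i = f j → i = j)
    (hmax : ∀ A' B' M', BPart f n A' B' M' →
      ∑ i ∈ Finset.range n, M' i ≤ ∑ i ∈ Finset.range n, M i)
    {x y x' y' : ℕ} (hx : x < n) (hx' : x' < n)
    (hxx : x + 1 = x' ∨ x' + 1 = x) (hyy : y + 1 = y' ∨ y' + 1 = y)
    (h1 : Ins B M x' y) (h2 : Ins B M x y') : Ins B M x y := by
  by_contra hc
  have hxl := h.le x hx
  have hxt := h.lt x hx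
  have hxl' := h.le x' hx'
  have hxt' := h.lt x' hx'
  have hne : ¬ Ins B M x' y' := by
    intro h3
    have := same_blk h hf hx hx' h2 h3
    apply hc
    unfold Ins at *
    omega
  have d1 : ¬ (A x ≤ x' ∧ x' < A x + M x) := by
    rintro ⟨u, v⟩
    have := h.con x hx x' u v
    apply hc
    unfold Ins at *
    omega
  have d2 : ¬ (A x' ≤ x ∧ x < A x' + M x') := by
    rintro ⟨u, v⟩
    have := h.con x' hx' x u v
    apply hc
    unfold Ins at *
    omega
  have B1 := h.blk x hx
  have B2 := h.blk x' hx'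
  unfold Ins at *
  rcases hxx with hxx | hxx
  · have e : A x + M x = A x' := by omega
    rcases hyy with hyy | hyy
    · have e2 : B x = B x' + M x' := by omega
      rw [← e] at B2
      rw [e2] at B1
      exact no_merge h hmax hx hx' e _ (B1.minus B2)
    · have e2 : B x' = B x + M x := by omega
      rw [← e, e2] at B2
      exact no_merge h hmax hx hx' e _ (B1.plus B2)
  · have e : A x' + M x' = A x := by omega
    rcases hyy with hyy | hyy
    · have e2 : B x = B x' + M x' := by omega
      rw [← e, e2] at B1
      exact no_merge h hmax hx' hx e _ (B2.plus B1)
    · have e2 : B x' = B x + M x := by omega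
      rw [← e] at B1
      rw [e2] at B2
      exact no_merge h hmax hx' hx e _ (B2.minus B1)

def ext {n : ℕ} (π : Equiv.Perm (Fin n)) (i : ℕ) : ℕ := if h : i < n then (π ⟨i, h⟩ : ℕ) else 0

lemma ext_fin {n : ℕ} (π : Equiv.Perm (Fin n)) (i : Fin n) : ext π i = π i := by
  simp [ext]

lemma full_blk {n : ℕ} (hn : 0 < n) (π : Equiv.Perm (Fin n)) (hπ : Full π) :
    Blk (ext π) 0 0 n := by
  have hf : ∀ i < n, ∀ j < n, ext π i = ext π j → i = j := by
    intro i hi j hj h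
    simp only [ext, hi, hj, dif_pos, Fin.val_inj, EmbeddingLike.apply_eq_iff_eq] at h
    simpa using h
  obtain ⟨A, B, M, h, hmax⟩ := exists_max (ext π) n
  let S : Set (Fin n × Fin n) := {p | Ins B M p.1 p.2}
  have hg : graphOf π ⊆ S := by
    rintro ⟨x, y⟩ hxy
    have hxy : y = π x := hxy
    subst hxy
    show Ins B M x (π x)
    have := ((h.blk x x.2).range (ext π x)).1 ⟨x, h.le x x.2, h.lt x x.2, rfl⟩
    rwa [ext_fin] at this
  have hcl : PercClosed S := by
    rintro ⟨x, y⟩ ⟨⟨x1, y1⟩, h1, ⟨x2, y2⟩, h2, hne, a1, a2⟩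
    have h1 : Ins B M x1 y1 := h1
    have h2 : Ins B M x2 y2 := h2
    show Ins B M x y
    simp only [Adj] at a1 a2
    have hne' : ¬ ((x1 : ℕ) = x2 ∧ (y1 : ℕ) = y2) := by
      rintro ⟨u, v⟩
      exact hne (Prod.ext (Fin.ext u) (Fin.ext v))
    rcases a1 with ⟨rfl, a1⟩ | ⟨rfl, a1⟩ <;> rcases a2 with ⟨rfl, a2⟩ | ⟨rfl, a2⟩
    · unfold Ins at *
      omega
    · exact diag h hf hmax x.2 x2.2 a2 a1 h2 h1
    · exact diag h hf hmax x.2 x1.2 a1 a2 h1 h2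
    · have := same_blk h hf x1.2 x2.2 h1 h2
      have l1 := h.le x1 x1.2
      have l2 := h.le x2 x2.2
      have t1 := h.lt x1 x1.2
      have t2 := h.lt x2 x2.2
      have := h.con x1 x1.2 x (by omega) (by omega)
      unfold Ins at *
      omega
  have hS : ∀ p, p ∈ S := by
    intro p
    have : p ∈ percClosure π := by rw [hπ]; trivial
    exact this S ⟨hg, hcl⟩
  have s1 : Ins B M 0 0 := hS (⟨0, hn⟩, ⟨0, hn⟩)
  have s2 : Ins B M 0 (n - 1) := hS (⟨0, hn⟩, ⟨n - 1, by omega⟩)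
  have e1 := h.le 0 hn
  have e2 := h.bd 0 hn
  have b := h.blk 0 hn
  unfold Ins at *
  have e3 : A 0 = 0 := by omega
  have e4 : B 0 = 0 := by omega
  have e5 : M 0 = n := by omega
  rwa [e3, e4, e5] at b

lemma fill {n : ℕ} {S : ℕ → ℕ → Prop}
    (hS : ∀ x y x' y', x < n → y < n → x' < n → y' < n → (x + 1 = x' ∨ x' + 1 = x) →
      (y + 1 = y' ∨ y' + 1 = y) → S x' y → S x y' → S x y)
    {g : List ℕ} (hg : Good g) : ∀ a b, a + g.length ≤ n → b + g.length ≤ n →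
      (∀ i (h : i < g.length), S (a + i) (b + g[i])) →
      ∀ i < g.length, ∀ j < g.length, S (a + i) (b + j) := by
  induction hg with
  | single =>
    intro a b _ _ h i hi j hj
    have hi : i = 0 := by simpa using hi
    have hj : j = 0 := by simpa using hj
    subst hi hj
    simpa using h 0 (by simp)
  | @plus x y hx hy h1 h2 =>
    intro a b ha hb h
    rw [opl_length] at ha hb
    have q1 := h1 a b (by omega) (by omega) (by
      intro i hi
      have := h i (by rw [opl_length]; omega)
      simp only [opl] at this
      rwa [List.getElem_append_left hi] at this)
    have q2 := h2 (a + x.length) (b + x.length) (by omega) (by omega) (by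
      intro i hi
      have := h (x.length + i) (by rw [opl_length]; omega)
      simp only [opl] at this
      rw [List.getElem_append_right (by omega)] at this
      simp at this
      convert this using 1 <;> omega)
    have q2' : ∀ i, x.length ≤ i → i < x.length + y.length → ∀ j, x.length ≤ j →
        j < x.length + y.length → S (a + i) (b + j) := by
      intro i hi hi' j hj hj'
      convert q2 (i - x.length) (by omega) (j - x.length) (by omega) using 1 <;> omega
    have q3 : ∀ d i j, i < x.length → x.length ≤ j → j < x.length + y.length → j - i = d →
        S (a + i) (b + j) := by
      intro d
      induction d using Nat.strong_induction_on with
      | _ d ih =>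
        intro i j hi hj hj' hd
        refine hS _ _ (a + (i + 1)) (b + (j - 1)) (by omega) (by omega) (by omega) (by omega)
          (by omega) (by omega) ?_ ?_
        · by_cases hc : i + 1 < x.length
          · exact ih (j - (i + 1)) (by omega) _ _ hc hj hj' rfl
          · exact q2' _ (by omega) (by have := hy.pos; omega) _ hj hj'
        · by_cases hc : x.length ≤ j - 1
          · exact ih (j - 1 - i) (by omega) _ _ hi hc (by omega) rfl
          · exact q1 _ hi _ (by omega)
    have q4 : ∀ d i j, j < x.length → x.length ≤ i → i < x.length + y.length → i - j = d →
        S (a + i) (b + j) := by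
      intro d
      induction d using Nat.strong_induction_on with
      | _ d ih =>
        intro i j hi hj hj' hd
        refine hS _ _ (a + (i - 1)) (b + (j + 1)) (by omega) (by omega) (by omega) (by omega)
          (by omega) (by omega) ?_ ?_
        · by_cases hc : x.length ≤ i - 1
          · exact ih (i - 1 - j) (by omega) _ _ hi hc (by omega) rfl
          · exact q1 _ (by omega) _ hi
        · by_cases hc : j + 1 < x.length
          · exact ih (i - (j + 1)) (by omega) _ _ hc hj hj' rfl
          · exact q2' _ hj hj' _ (by omega) (by have := hy.pos; omega)
    intro i hi j hj
    rw [opl_length] at hi hj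
    by_cases c1 : i < x.length <;> by_cases c2 : j < x.length
    · exact q1 i c1 j c2
    · exact q3 _ i j c1 (by omega) hj rfl
    · exact q4 _ i j c2 (by omega) hi rfl
    · exact q2' i (by omega) hi j (by omega) hj
  | @minus x y hx hy h1 h2 =>
    intro a b ha hb h
    rw [omi_length] at ha hb
    have hxp := hx.pos
    have hyp := hy.pos
    have q1 := h1 a (b + y.length) (by omega) (by omega) (by
      intro i hi
      have := h i (by rw [omi_length]; omega)
      simp only [omi] at this
      rw [List.getElem_append_left (by simpa using hi)] at this
      simp at this
      convert this using 1
      omega)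
    have q2 := h2 (a + x.length) b (by omega) (by omega) (by
      intro i hi
      have := h (x.length + i) (by rw [omi_length]; omega)
      simp only [omi] at this
      rw [List.getElem_append_right (by simp)] at this
      simp at this
      convert this using 1
      omega)
    have q1' : ∀ i < x.length, ∀ j, y.length ≤ j →
        j < x.length + y.length → S (a + i) (b + j) := by
      intro i hi j hj hj'
      convert q1 i hi (j - y.length) (by omega) using 1
      omega
    have q2' : ∀ i, x.length ≤ i → i < x.length + y.length → ∀ j < y.length,
        S (a + i) (b + j) := by
      intro i hi hi' j hj
      convert q2 (i - x.length) (by omega) j hj using 1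
      omega
    have q3 : ∀ d i j, i < x.length → j < y.length → x.length - i + (y.length - j) = d →
        S (a + i) (b + j) := by
      intro d
      induction d using Nat.strong_induction_on with
      | _ d ih =>
        intro i j hi hj hd
        refine hS _ _ (a + (i + 1)) (b + (j + 1)) (by omega) (by omega) (by omega) (by omega)
          (by omega) (by omega) ?_ ?_
        · by_cases hc : i + 1 < x.length
          · exact ih _ (by omega) _ _ hc hj rfl
          · exact q2' _ (by omega) (by omega) _ hj
        · by_cases hc : j + 1 < y.length
          · exact ih _ (by omega) _ _ hi hc rfl
          · exact q1' _ hi _ (by omega) (by omega)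
    have q4 : ∀ d i j, x.length ≤ i → i < x.length + y.length → y.length ≤ j →
        j < x.length + y.length → i + j = d → S (a + i) (b + j) := by
      intro d
      induction d using Nat.strong_induction_on with
      | _ d ih =>
        intro i j hi hi' hj hj' hd
        refine hS _ _ (a + (i - 1)) (b + (j - 1)) (by omega) (by omega) (by omega) (by omega)
          (by omega) (by omega) ?_ ?_
        · by_cases hc : x.length ≤ i - 1
          · exact ih _ (by omega) _ _ hc (by omega) hj hj' rfl
          · exact q1' _ (by omega) _ hj hj'
        · by_cases hc : y.length ≤ j - 1
          · exact ih _ (by omega) _ _ hi hi' hc (by omega) rfl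
          · exact q2' _ hi hi' _ (by omega)
    intro i hi j hj
    rw [omi_length] at hi hj
    by_cases c1 : i < x.length <;> by_cases c2 : j < y.length
    · exact q3 _ i j c1 c2 rfl
    · exact q1' i c1 j (by omega) hj
    · exact q2' i (by omega) hi j c2
    · exact q4 _ i j (by omega) hi (by omega) hj rfl

def toL {n : ℕ} (π : Equiv.Perm (Fin n)) : List ℕ := List.ofFn (fun i => (π i : ℕ))

lemma full_iff {n : ℕ} (hn : 0 < n) (π : Equiv.Perm (Fin n)) : Full π ↔ Good (toL π) := by
  constructor
  · intro h
    have := (full_blk hn π h).good.1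
    convert this using 1
    apply List.ext_getElem
    · simp [toL]
    · intro i h1 h2
      simp [toL] at h1
      simp [toL, ext, h1]
  · intro h
    apply Set.eq_univ_of_forall
    rintro ⟨x, y⟩ S ⟨hg, hcl⟩
    have := fill (n := n) (S := fun i j => ∃ (hi : i < n) (hj : j < n),
      ((⟨i, hi⟩, ⟨j, hj⟩) : Fin n × Fin n) ∈ S) (by
        rintro x y x' y' hx hy hx' hy' h1 h2 ⟨_, _, s1⟩ ⟨_, _, s2⟩
        refine ⟨hx, hy, hcl _ ⟨_, s1, _, s2, ?_, ?_, ?_⟩⟩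
        · simp; omega
        · right; simpa using h1
        · left; simpa using h2) h 0 0 (by simp [toL]) (by simp [toL]) (by
        intro i hi
        have hi : i < n := by simpa [toL] using hi
        refine ⟨by omega, by simp [toL], ?_⟩
        apply hg
        simp [graphOf, toL]) x (by simp [toL]) y (by simp [toL])
    simpa using this

lemma numFull_eq {n : ℕ} (hn : 0 < n) : numFull n = (W n).card := by
  have hinj : Function.Injective (toL (n := n)) := by
    intro π σ h
    have := List.ofFn_injective h
    ext i
    exact congrFun this i
  rw [numFull, Nat.card_congr (Equiv.subtypeEquivRight (full_iff hn)), ← Fintype.card_coe,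
    ← Nat.card_eq_fintype_card]
  refine Nat.card_congr (Equiv.ofBijective
    (fun p => ⟨toL p.1, mem_W.2 ⟨p.2, by simp [toL]⟩⟩) ⟨?_, ?_⟩)
  · rintro ⟨π, _⟩ ⟨σ, _⟩ h
    simp only [Subtype.mk.injEq] at h
    exact Subtype.ext (hinj h)
  · rintro ⟨l, hl⟩
    obtain ⟨hg, hlen⟩ := mem_W.1 hl
    have hnd : l.Nodup := (hg.perm.nodup_iff).2 List.nodup_range
    let f : Fin n → Fin n := fun i => ⟨l[(i : ℕ)]'(by omega), by
      have := (hg.mem _).1 (List.getElem_mem (l := l) (n := (i : ℕ)) (by omega)); omega⟩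
    have hfi : Function.Injective f := by
      intro i j h
      simp only [f, Fin.mk.injEq] at h
      exact Fin.ext ((hnd.getElem_inj_iff).1 h)
    let π : Equiv.Perm (Fin n) := Equiv.ofBijective f (Finite.injective_iff_bijective.1 hfi)
    have hπ : toL π = l := by
      apply List.ext_getElem
      · simp [toL, hlen]
      · intro i h1 h2
        simp [toL, π, f]
    exact ⟨⟨π, by rw [hπ]; exact hg⟩, Subtype.ext hπ⟩

theorem stmt_14 (S : ℕ → ℕ) (hS0 : S 0 = 1)
    (hS : ∀ n, S (n + 1) = S n + ∑ j ∈ Finset.range (n + 1), S j * S (n - j)) :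
    ∀ n : ℕ, 1 ≤ n → numFull n = S (n - 1) := by
  intro n hn
  obtain ⟨m, rfl⟩ : ∃ m, n = m + 1 := ⟨n - 1, by omega⟩
  rw [numFull_eq hn, card_W_S S hS0 hS]
  simp
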